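/- arXiv:1206.0871 — 5 statements merged into one kernel-verified Lean document; each statement's English description precedes it below -/
import Mathlib

section
/- Let X be a nonnegative random variable with finite ψ_1 norm. Then for every z ≥ 1, E X² ≤ log(ez) · ‖X‖_{ψ_1} · E X + (4 + 6 log²(ez)) ‖X‖_{ψ_1}² / (ez). -/
open MeasureTheory Real

noncomputable section

/-- The set of admissible constants in the definition of the ψ₁ (sub-exponential)
Orlicz norm of a random variable `W` under the measure `μ`. -/
def psi1Set {Ω : Type*} [MeasurableSpace Ω] (μ : Measure Ω) (W : Ω → ℝ) : Set ℝ :=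
  {c : ℝ | 0 < c ∧ ∫⁻ ω, ENNReal.ofReal (Real.exp (|W ω| / c)) ∂μ ≤ 2}

/-- The ψ₁ (sub-exponential) Orlicz norm `‖W‖_{ψ₁}`. -/
def psi1 {Ω : Type*} [MeasurableSpace Ω] (μ : Measure Ω) (W : Ω → ℝ) : ℝ :=
  sInf (psi1Set μ W)

/-- Elementary pointwise inequality behind the bound. -/
theorem pointwise_aux (L u : ℝ) (hL : 1 ≤ L) (hu : 0 ≤ u) :
    u ^ 2 ≤ L * u + (2 + L) * Real.exp (u - L) := by
  have hp := Real.exp_pos (u - L)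
  rcases le_total u L with h | h
  · nlinarith
  · have h1 := Real.quadratic_le_exp_of_nonneg (sub_nonneg.2 h)
    have hv : 0 ≤ u - L := sub_nonneg.2 h
    have h2 : (u - L) ^ 2 ≤ 2 * Real.exp (u - L) := by nlinarith
    have h3 : u - L ≤ Real.exp (u - L) := by nlinarith
    nlinarith

/-- The bound for every admissible constant `c`. -/
theorem bound_aux {Ω : Type*} [MeasurableSpace Ω] (μ : Measure Ω)
    [IsProbabilityMeasure μ] (X : Ω → ℝ) (hX : Measurable X)
    (hpos : ∀ᵐ ω ∂μ, 0 ≤ X ω) (L c : ℝ) (hL : 1 ≤ L) (hc : c ∈ psi1Set μ X) :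
    ∫ ω, (X ω) ^ 2 ∂μ ≤
      L * c * ∫ ω, X ω ∂μ + (4 + 6 * L ^ 2) * c ^ 2 / Real.exp L := by
  obtain ⟨c0, h2⟩ := hc
  have hm : Measurable (fun ω => Real.exp (|X ω| / c)) := by fun_prop
  have hE : Integrable (fun ω => Real.exp (|X ω| / c)) μ := by
    refine ⟨hm.aestronglyMeasurable, ?_⟩
    rw [hasFiniteIntegral_iff_ofReal (Filter.Eventually.of_forall fun ω => (Real.exp_pos _).le)]
    exact lt_of_le_of_lt h2 (by simp)
  have hE2 : ∫ ω, Real.exp (|X ω| / c) ∂μ ≤ 2 := by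
    rw [integral_eq_lintegral_of_nonneg_ae
      (Filter.Eventually.of_forall fun ω => (Real.exp_pos _).le) hm.aestronglyMeasurable]
    exact ENNReal.toReal_le_of_le_ofReal (by norm_num) (by simpa using h2)
  have hXi : Integrable X μ := by
    refine (hE.const_mul c).mono' hX.aestronglyMeasurable (Filter.Eventually.of_forall fun ω => ?_)
    have := Real.add_one_le_exp (|X ω| / c)
    have h3 : |X ω| / c ≤ Real.exp (|X ω| / c) := by linarith
    rw [div_le_iff₀ c0] at h3
    simpa [mul_comm] using h3
  have key : ∫ ω, (X ω) ^ 2 ∂μ ≤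
      ∫ ω, (L * c * X ω + (2 + L) * c ^ 2 / Real.exp L * Real.exp (|X ω| / c)) ∂μ := by
    refine integral_mono_of_nonneg (Filter.Eventually.of_forall fun ω => sq_nonneg _)
      ((hXi.const_mul _).add (hE.const_mul _)) ?_
    filter_upwards [hpos] with ω hω
    have h4 := pointwise_aux L (X ω / c) hL (by positivity)
    rw [Real.exp_sub] at h4
    have h5 := mul_le_mul_of_nonneg_left h4 (sq_nonneg c)
    rw [abs_of_nonneg hω]
    have e1 : c ^ 2 * (X ω / c) ^ 2 = X ω ^ 2 := by field_simp
    have e2 : c ^ 2 * (L * (X ω / c) + (2 + L) * (Real.exp (X ω / c) / Real.exp L)) =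
        L * c * X ω + (2 + L) * c ^ 2 / Real.exp L * Real.exp (X ω / c) := by field_simp
    rw [e1, e2] at h5
    exact h5
  rw [integral_add (hXi.const_mul _) (hE.const_mul _), integral_const_mul,
    integral_const_mul] at key
  have h6 : (2 + L) * c ^ 2 / Real.exp L * ∫ ω, Real.exp (|X ω| / c) ∂μ ≤
      (2 + L) * c ^ 2 / Real.exp L * 2 :=
    mul_le_mul_of_nonneg_left hE2 (by positivity)
  have h7 : (2 + L) * c ^ 2 / Real.exp L * 2 ≤ (4 + 6 * L ^ 2) * c ^ 2 / Real.exp L := by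
    rw [div_mul_eq_mul_div]
    refine div_le_div_of_nonneg_right ?_ (Real.exp_pos L).le
    nlinarith [mul_nonneg (sq_nonneg c) (by nlinarith : 0 ≤ 6 * L ^ 2 - 2 * L)]
  linarith

/-- **Second moment of a nonnegative sub-exponential random variable.**
For every `z ≥ 1`,
`E X² ≤ log(ez) ‖X‖_{ψ₁} E X + (4 + 6 log²(ez)) ‖X‖_{ψ₁}² / (ez)`. -/
theorem second_moment_subexponential {Ω : Type*} [MeasurableSpace Ω] (μ : Measure Ω)
    [IsProbabilityMeasure μ] (X : Ω → ℝ) (hX : Measurable X)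
    (hpos : ∀ᵐ ω ∂μ, 0 ≤ X ω) (hfin : (psi1Set μ X).Nonempty) :
    ∀ z : ℝ, 1 ≤ z →
      ∫ ω, (X ω) ^ 2 ∂μ ≤
        Real.log (Real.exp 1 * z) * psi1 μ X * ∫ ω, X ω ∂μ +
          (4 + 6 * (Real.log (Real.exp 1 * z)) ^ 2) * (psi1 μ X) ^ 2 /
            (Real.exp 1 * z) := by
  intro z hz
  have hz0 : 0 < z := by linarith
  have hL : 1 ≤ Real.log (Real.exp 1 * z) := by
    rw [Real.log_mul (Real.exp_pos 1).ne' hz0.ne', Real.log_exp]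
    linarith [Real.log_nonneg hz]
  have hexp : Real.exp (Real.log (Real.exp 1 * z)) = Real.exp 1 * z :=
    Real.exp_log (by positivity)
  have hmem : psi1 μ X ∈ closure (psi1Set μ X) :=
    csInf_mem_closure hfin ⟨0, fun c hc => hc.1.le⟩
  have hcl : IsClosed {c : ℝ | ∫ ω, (X ω) ^ 2 ∂μ ≤
      Real.log (Real.exp 1 * z) * c * ∫ ω, X ω ∂μ +
        (4 + 6 * (Real.log (Real.exp 1 * z)) ^ 2) * c ^ 2 / (Real.exp 1 * z)} :=
    isClosed_le (by fun_prop) (by fun_prop)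
  refine closure_minimal (fun c hc => ?_) hcl hmem
  have := bound_aux μ X hX hpos _ c hL hc
  rwa [hexp] at this
end
end

section
/- Let X be a nonnegative random variable with finite ψ_1 norm. Then for every θ > 0, E[ X² · 1_{X ≥ θ} ] ≤ ( 2θ² + 4θ‖X‖_{ψ_1} + 4‖X‖_{ψ_1}² ) · exp( −θ/‖X‖_{ψ_1} ). -/
open MeasureTheory Real

noncomputable section

lemma trunc_pointwise (x θ c : ℝ) (hc : 0 < c) (hθ : 0 < θ) (hx : θ ≤ x) :
    x ^ 2 ≤ (θ ^ 2 + 2 * θ * c + 2 * c ^ 2) * Real.exp (-θ / c) * Real.exp (|x| / c) := by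
  have hs : 0 ≤ (x - θ) / c := div_nonneg (by linarith) hc.le
  have hq := Real.quadratic_le_exp_of_nonneg hs
  have he : Real.exp (-θ / c) * Real.exp (|x| / c) = Real.exp ((x - θ) / c) := by
    rw [← Real.exp_add, abs_of_pos (by linarith)]
    congr 1
    ring
  rw [mul_assoc, he]
  set s := (x - θ) / c with hsdef
  have hxs : x = θ + c * s := by
    rw [hsdef]
    field_simp
    ring
  have hA : 0 ≤ θ ^ 2 + 2 * θ * c + 2 * c ^ 2 := by positivity
  refine le_trans ?_ (mul_le_mul_of_nonneg_left hq hA)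
  rw [hxs]
  have h : 0 ≤ θ ^ 2 * (s + s ^ 2 / 2) + 2 * θ * c * (1 + s ^ 2 / 2) + 2 * c ^ 2 * (1 + s) := by
    positivity
  nlinarith [h]

lemma trunc_fixed {Ω : Type*} [MeasurableSpace Ω]
    (μ : Measure Ω) (X : Ω → ℝ) (hX : Measurable X)
    (c : ℝ) (hc : c ∈ psi1Set μ X) (θ : ℝ) (hθ : 0 < θ) :
    ∫ ω in {ω | θ ≤ X ω}, (X ω) ^ 2 ∂μ ≤
      (2 * θ ^ 2 + 4 * θ * c + 4 * c ^ 2) * Real.exp (-θ / c) := by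
  obtain ⟨hc0, hint⟩ := hc
  have hm : Measurable fun ω => Real.exp (|X ω| / c) := by
    have : Measurable fun ω => |X ω| := by simpa using hX.norm
    exact Real.measurable_exp.comp (this.div_const c)
  have hnn : ∀ ω, 0 ≤ Real.exp (|X ω| / c) := fun ω => (Real.exp_pos _).le
  have hI : Integrable (fun ω => Real.exp (|X ω| / c)) μ := by
    refine ⟨hm.aestronglyMeasurable, ?_⟩
    rw [hasFiniteIntegral_iff_ofReal (Filter.Eventually.of_forall hnn)]
    exact lt_of_le_of_lt hint (by simp)
  have hE : ∫ ω, Real.exp (|X ω| / c) ∂μ ≤ 2 := by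
    rw [integral_eq_lintegral_of_nonneg_ae (Filter.Eventually.of_forall hnn)
      hm.aestronglyMeasurable]
    exact ENNReal.toReal_le_of_le_ofReal (by norm_num) (by simpa using hint)
  have hA : 0 ≤ (θ ^ 2 + 2 * θ * c + 2 * c ^ 2) * Real.exp (-θ / c) := by positivity
  have hms : MeasurableSet {ω | θ ≤ X ω} := measurableSet_le measurable_const hX
  calc ∫ ω in {ω | θ ≤ X ω}, (X ω) ^ 2 ∂μ
      ≤ ∫ ω in {ω | θ ≤ X ω},
          (θ ^ 2 + 2 * θ * c + 2 * c ^ 2) * Real.exp (-θ / c) * Real.exp (|X ω| / c) ∂μ := by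
        refine integral_mono_of_nonneg (Filter.Eventually.of_forall fun ω => sq_nonneg _)
          (hI.const_mul _).integrableOn ?_
        filter_upwards [ae_restrict_mem hms] with ω hω
        exact trunc_pointwise _ _ _ hc0 hθ hω
    _ ≤ ∫ ω, (θ ^ 2 + 2 * θ * c + 2 * c ^ 2) * Real.exp (-θ / c) * Real.exp (|X ω| / c) ∂μ :=
        setIntegral_le_integral (hI.const_mul _)
          (Filter.Eventually.of_forall fun ω => mul_nonneg hA (hnn ω))
    _ = (θ ^ 2 + 2 * θ * c + 2 * c ^ 2) * Real.exp (-θ / c) *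
          ∫ ω, Real.exp (|X ω| / c) ∂μ := integral_const_mul _ _
    _ ≤ (θ ^ 2 + 2 * θ * c + 2 * c ^ 2) * Real.exp (-θ / c) * 2 :=
        mul_le_mul_of_nonneg_left hE hA
    _ = _ := by ring

/-- **Truncated second moment of a nonnegative sub-exponential random variable.**
For every `θ > 0`,
`E[X² 1_{X ≥ θ}] ≤ (2θ² + 4θ‖X‖_{ψ₁} + 4‖X‖_{ψ₁}²) exp(−θ/‖X‖_{ψ₁})`. -/
theorem truncated_second_moment_subexponential {Ω : Type*} [MeasurableSpace Ω]
    (μ : Measure Ω) [IsProbabilityMeasure μ] (X : Ω → ℝ) (hX : Measurable X)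
    (hpos : ∀ᵐ ω ∂μ, 0 ≤ X ω) (hfin : (psi1Set μ X).Nonempty) :
    ∀ θ : ℝ, 0 < θ →
      ∫ ω in {ω | θ ≤ X ω}, (X ω) ^ 2 ∂μ ≤
        (2 * θ ^ 2 + 4 * θ * psi1 μ X + 4 * (psi1 μ X) ^ 2) *
          Real.exp (-θ / psi1 μ X) := by
  intro θ hθ
  have hbdd : BddBelow (psi1Set μ X) := ⟨0, fun c hc => hc.1.le⟩
  have hcl : psi1 μ X ∈ closure (psi1Set μ X) := csInf_mem_closure hfin hbdd
  have h0 : 0 ≤ psi1 μ X := le_csInf hfin fun c hc => hc.1.le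
  have hne : (nhdsWithin (psi1 μ X) (psi1Set μ X)).NeBot := mem_closure_iff_nhdsWithin_neBot.1 hcl
  rcases h0.eq_or_lt with h | h
  · have hcont : ContinuousAt (fun c : ℝ => 2 * θ ^ 2 + 4 * θ * c + 4 * c ^ 2) (psi1 μ X) := by
      fun_prop
    have := ge_of_tendsto (hcont.tendsto.mono_left (nhdsWithin_le_nhds (s := psi1Set μ X)))
      (b := ∫ ω in {ω | θ ≤ X ω}, (X ω) ^ 2 ∂μ) (by
        filter_upwards [self_mem_nhdsWithin] with c hc
        have hc0 : 0 < c := hc.1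
        refine (trunc_fixed μ X hX c hc θ hθ).trans
          (mul_le_of_le_one_right (by positivity) ?_)
        rw [Real.exp_le_one_iff]
        exact div_nonpos_of_nonpos_of_nonneg (by linarith) hc0.le)
    simpa [← h] using this
  · have hcont : ContinuousAt
        (fun c : ℝ => (2 * θ ^ 2 + 4 * θ * c + 4 * c ^ 2) * Real.exp (-θ / c)) (psi1 μ X) := by
      have hd : ContinuousAt (fun c : ℝ => -θ / c) (psi1 μ X) :=
        continuousAt_const.div continuousAt_id h.ne'
      fun_prop
    refine ge_of_tendsto (hcont.tendsto.mono_left (nhdsWithin_le_nhds (s := psi1Set μ X))) ?_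
    filter_upwards [self_mem_nhdsWithin] with c hc
    exact trunc_fixed μ X hX c hc θ hθ
end
end

section
/- There exists an absolute constant c_0 > 0 such that: if ℓ is a random variable with ℓ ≥ 0 almost surely and ‖ℓ‖_{ψ_1} ≤ D for some D ≥ 1, then for every integer n ≥ 1, E ℓ² ≤ ( c_0 D log(en) ) · E ℓ + ( c_0 D log(en) )² / n. -/
open MeasureTheory Real

noncomputable section

/-- **Bernstein-type condition for a nonnegative sub-exponential loss.**
If `ℓ ≥ 0` a.s. and `‖ℓ‖_{ψ₁} ≤ D` with `D ≥ 1`, then for every `n ≥ 1`,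
`E ℓ² ≤ (c₀ D log(en)) E ℓ + (c₀ D log(en))²/n`. -/
theorem bernstein_condition_subexponential_loss :
    ∃ c₀ : ℝ, 0 < c₀ ∧
      ∀ (Ω : Type) (_ : MeasurableSpace Ω) (μ : Measure Ω), IsProbabilityMeasure μ →
      ∀ (ℓ : Ω → ℝ), Measurable ℓ → (∀ᵐ ω ∂μ, 0 ≤ ℓ ω) →
      ∀ (D : ℝ), 1 ≤ D →
        -- `‖ℓ‖_{ψ₁} ≤ D`
        D ∈ psi1Set μ ℓ →
      ∀ (n : ℕ), 1 ≤ n →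
        ∫ ω, (ℓ ω) ^ 2 ∂μ ≤
          (c₀ * D * Real.log (Real.exp 1 * n)) * ∫ ω, ℓ ω ∂μ +
            (c₀ * D * Real.log (Real.exp 1 * n)) ^ 2 / n := by
  refine ⟨4, by norm_num, ?_⟩
  intro Ω _ μ hμ ℓ hm hpos D hD hpsi n hn
  obtain ⟨hD0, hint⟩ := hpsi
  have hn1 : (1 : ℝ) ≤ n := by exact_mod_cast hn
  have hn0 : (0 : ℝ) < n := by linarith
  set L := Real.log (Real.exp 1 * n) with hL
  have hLexp : Real.exp L = Real.exp 1 * n := Real.exp_log (by positivity)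
  have hL1 : 1 ≤ L := by
    rw [hL, Real.log_mul (Real.exp_pos 1).ne' hn0.ne', Real.log_exp]
    linarith [Real.log_nonneg hn1]
  have hem : Measurable (fun ω => Real.exp (|ℓ ω| / D)) := by
    have : Measurable (fun ω => |ℓ ω|) := hm.abs
    exact (this.div_const D).exp
  have hei : Integrable (fun ω => Real.exp (|ℓ ω| / D)) μ := by
    refine ⟨hem.aestronglyMeasurable, ?_⟩
    rw [hasFiniteIntegral_iff_ofReal (Filter.Eventually.of_forall fun ω => (Real.exp_pos _).le)]
    exact lt_of_le_of_lt hint (by simp)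
  have he2 : ∫ ω, Real.exp (|ℓ ω| / D) ∂μ ≤ 2 := by
    rw [integral_eq_lintegral_of_nonneg_ae
      (Filter.Eventually.of_forall fun ω => (Real.exp_pos _).le) hem.aestronglyMeasurable]
    exact ENNReal.toReal_le_of_le_ofReal (by norm_num) (by simpa using hint)
  have hli : Integrable ℓ μ := by
    refine (hei.const_mul D).mono' hm.aestronglyMeasurable
      (Filter.Eventually.of_forall fun ω => ?_)
    have h1 := Real.add_one_le_exp (|ℓ ω| / D)
    rw [Real.norm_eq_abs]
    calc |ℓ ω| = D * (|ℓ ω| / D) := by field_simp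
      _ ≤ D * Real.exp (|ℓ ω| / D) := by gcongr; linarith
  have key : ∀ x : ℝ, 0 ≤ x → x ^ 2 ≤ 4 * L * x + 8 / n * Real.exp x := by
    intro x hx
    have hE : 0 ≤ 8 / n * Real.exp x := by positivity
    rcases le_total x (2 * L) with h | h
    · nlinarith
    · have h1 : Real.exp x = Real.exp (x / 2) * Real.exp (x / 2) := by
        rw [← Real.exp_add]; ring_nf
      have h2 : (n : ℝ) ≤ Real.exp (x / 2) := by
        have h3 : Real.exp L ≤ Real.exp (x / 2) := Real.exp_le_exp.2 (by linarith)
        have h4 := Real.add_one_le_exp (1 : ℝ)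
        nlinarith
      have h5 := Real.quadratic_le_exp_of_nonneg (x := x / 2) (by linarith)
      have h6 : x ^ 2 / 8 * n ≤ Real.exp x := by
        rw [h1]
        gcongr
        nlinarith
      have h7 : x ^ 2 ≤ 8 / n * Real.exp x := by
        rw [div_mul_eq_mul_div, le_div_iff₀ hn0]
        linarith
      have : 0 ≤ 4 * L * x := by positivity
      linarith
  have hmono : ∫ ω, (ℓ ω) ^ 2 ∂μ ≤
      ∫ ω, ((4 * D * L) * ℓ ω + D ^ 2 * (8 / n) * Real.exp (|ℓ ω| / D)) ∂μ := by
    refine integral_mono_of_nonneg (Filter.Eventually.of_forall fun ω => sq_nonneg _)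
      ((hli.const_mul _).add (hei.const_mul _)) ?_
    filter_upwards [hpos] with ω hω
    have h := key (ℓ ω / D) (by positivity)
    rw [abs_of_nonneg hω]
    calc ℓ ω ^ 2 = D ^ 2 * (ℓ ω / D) ^ 2 := by field_simp
      _ ≤ D ^ 2 * (4 * L * (ℓ ω / D) + 8 / n * Real.exp (ℓ ω / D)) := by gcongr
      _ = _ := by field_simp
  rw [integral_add (hli.const_mul _) (hei.const_mul _), integral_const_mul,
    integral_const_mul] at hmono
  refine hmono.trans ?_
  gcongr
  calc D ^ 2 * (8 / n) * ∫ ω, Real.exp (|ℓ ω| / D) ∂μ ≤ D ^ 2 * (8 / n) * 2 := by gcongr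
    _ = (4 * D * 1) ^ 2 / n := by ring
    _ ≤ _ := by gcongr
end
end

section
/- There exists an absolute constant K′ > 0 for which the following holds. Let Z_1, …, Z_n be i.i.d. random variables with law P and let g : 𝒵 → ℝ be measurable with b_n(g) < ∞, and suppose there exists B_n ≥ 0 such that P g² ≤ B_n · P g + B_n²/n. Then for every 0 < α < 1 and x > 0, with probability at least 1 − 4 e^{−x}, P_n g ≤ (1 + 2α) P g + K′ (1 + α^{−1}) ( b_n(g) + B_n ) (x + 1)/n. -/
open MeasureTheory Real

noncomputable section

/-- The empirical mean `P_n g = (1/n) ∑_{i=1}^n g(Z_i)` of `g` over the sample `ω`. -/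
def empMean {𝒵 : Type*} (n : ℕ) (g : 𝒵 → ℝ) (ω : Fin n → 𝒵) : ℝ :=
  (∑ i, g (ω i)) / n

/-- `b_n(g)`: the ψ₁ norm of `max_{1 ≤ i ≤ n} |g(Z_i)|` under the sample measure. -/
def bnFun {𝒵 : Type*} [MeasurableSpace 𝒵] (P : Measure 𝒵) (n : ℕ) (g : 𝒵 → ℝ) : ℝ :=
  psi1 (Measure.pi fun _ : Fin n => P) (fun ω => ⨆ k : Fin n, |g (ω k)|)

lemma aux_lintegral_pi_prod {𝒵 : Type} [MeasurableSpace 𝒵] (P : Measure 𝒵)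
    [IsProbabilityMeasure P] {n : ℕ} (f : Fin n → 𝒵 → ENNReal) (hf : ∀ i, Measurable (f i)) :
    ∫⁻ ω, ∏ i, f i (ω i) ∂(Measure.pi fun _ : Fin n => P) = ∏ i, ∫⁻ z, f i z ∂P := by
  have h := ProbabilityTheory.iIndepFun_pi (μ := fun _ : Fin n => P) (X := f)
    (fun i => (hf i).aemeasurable)
  have h2 := ProbabilityTheory.lintegral_prod_eq_prod_lintegral_of_indepFun Finset.univ _ h
    (fun i => (hf i).comp (measurable_pi_apply i))
  rw [h2]
  refine Finset.prod_congr rfl fun i _ => ?_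
  exact (measurePreserving_eval (fun _ : Fin n => P) i).lintegral_comp (hf i)

lemma aux_tail {𝒵 : Type} [MeasurableSpace 𝒵] (P : Measure 𝒵)
    [IsProbabilityMeasure P] {n : ℕ} (hn : 0 < n) (g : 𝒵 → ℝ) (hg : Measurable g) (c : ℝ)
    (hc : c ∈ psi1Set (Measure.pi fun _ : Fin n => P) (fun ω => ⨆ k : Fin n, |g (ω k)|)) :
    (n : ENNReal) * ∫⁻ z, {z | c * Real.log 4 < |g z|}.indicator
      (fun z => ENNReal.ofReal (Real.exp (|g z| / c))) z ∂P ≤ 4 := by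
  obtain ⟨hc0, hc2⟩ := hc
  haveI : Nonempty (Fin n) := ⟨⟨0, hn⟩⟩
  set T : Set 𝒵 := {z | c * Real.log 4 < |g z|} with hT
  have hTm : MeasurableSet T := measurableSet_lt measurable_const (by fun_prop)
  set M : (Fin n → 𝒵) → ℝ := fun ω => ⨆ k : Fin n, |g (ω k)| with hM
  have hMm : Measurable M := by
    apply Measurable.iSup
    intro i
    exact (hg.comp (measurable_pi_apply i)).abs
  have hle : ∀ ω k, |g (ω k)| ≤ M ω := fun ω k => le_ciSup (f := fun k => |g (ω k)|)
    (Set.finite_range _).bddAbove k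
  have hM0 : ∀ ω, 0 ≤ M ω := fun ω => (abs_nonneg _).trans (hle ω ⟨0, hn⟩)
  set F : (Fin n → 𝒵) → ENNReal := fun ω => ENNReal.ofReal (Real.exp (|M ω| / c)) with hF
  have hFm : Measurable F := by fun_prop
  set μ := Measure.pi fun _ : Fin n => P with hμ
  have hc2' : ∫⁻ ω, F ω ∂μ ≤ 2 := hc2
  set q := P Tᶜ with hq
  -- probability that all are small
  have hsmall : q ^ n = μ (Set.univ.pi fun _ => Tᶜ) := by
    rw [hμ, Measure.pi_pi]; simp [hq]
  have hsm : MeasurableSet (Set.univ.pi fun _ : Fin n => Tᶜ) :=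
    MeasurableSet.univ_pi fun _ => hTm.compl
  have hbig : (4 : ENNReal) * μ (Set.univ.pi fun _ : Fin n => Tᶜ)ᶜ ≤ 2 := by
    refine le_trans ?_ hc2'
    refine le_trans ?_ (mul_meas_ge_le_lintegral hFm 4)
    gcongr
    intro ω hω
    simp only [Set.mem_compl_iff, Set.mem_pi, Set.mem_univ, true_implies, not_forall, not_not] at hω
    obtain ⟨i, hi⟩ := hω
    have hi' : c * Real.log 4 < |g (ω i)| := hi
    have h1 : Real.log 4 ≤ |M ω| / c := by
      rw [le_div_iff₀ hc0, abs_of_nonneg (hM0 ω)]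
      linarith [hle ω i]
    have h2 : (4 : ℝ) ≤ Real.exp (|M ω| / c) := by
      rw [← Real.log_le_iff_le_exp (by norm_num)]; exact h1
    show (4 : ENNReal) ≤ ENNReal.ofReal _
    have := ENNReal.ofReal_le_ofReal h2
    simpa using this
  have hqn : (1 : ENNReal) / 2 ≤ q ^ n := by
    rw [hsmall]
    have h1 : μ (Set.univ.pi fun _ : Fin n => Tᶜ) + μ (Set.univ.pi fun _ : Fin n => Tᶜ)ᶜ = 1 :=
      prob_add_prob_compl hsm
    have ha : μ (Set.univ.pi fun _ : Fin n => Tᶜ) ≠ ⊤ := measure_ne_top _ _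
    have hb : μ (Set.univ.pi fun _ : Fin n => Tᶜ)ᶜ ≠ ⊤ := measure_ne_top _ _
    generalize μ (Set.univ.pi fun _ : Fin n => Tᶜ) = a at *
    generalize μ (Set.univ.pi fun _ : Fin n => Tᶜ)ᶜ = b at *
    lift a to NNReal using ha
    lift b to NNReal using hb
    have h1' : a + b = 1 := by exact_mod_cast h1
    have h2' : 4 * b ≤ 2 := by exact_mod_cast hbig
    have : (1 / 2 : NNReal) ≤ a := by
      rw [← NNReal.coe_le_coe] at h2' ⊢
      have := congrArg NNReal.toReal h1'
      push_cast at *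
      linarith
    have h3 : ((1 / 2 : NNReal) : ENNReal) ≤ a := by exact_mod_cast this
    simpa using h3
  have hqn1 : (1 : ENNReal) / 2 ≤ q ^ (n - 1) :=
    hqn.trans (pow_le_pow_right_of_le_one' prob_le_one (Nat.sub_le n 1))
  set G : 𝒵 → ENNReal := T.indicator (fun z => ENNReal.ofReal (Real.exp (|g z| / c))) with hG
  have hGm : Measurable G := by
    apply Measurable.indicator _ hTm
    fun_prop
  set f : Fin n → Fin n → 𝒵 → ENNReal := fun i j => if j = i then G else Tᶜ.indicator 1 with hf
  have hfm : ∀ i j, Measurable (f i j) := by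
    intro i j
    simp only [hf]
    split_ifs
    · exact hGm
    · exact measurable_one.indicator hTm.compl
  have hprod : ∀ i, ∫⁻ ω, ∏ j, f i j (ω j) ∂μ = (∫⁻ z, G z ∂P) * q ^ (n - 1) := by
    intro i
    rw [hμ, aux_lintegral_pi_prod P (f i) (hfm i), ← Finset.mul_prod_erase _ _ (Finset.mem_univ i)]
    congr 1
    · simp [hf]
    · rw [Finset.prod_congr rfl (g := fun _ => q)]
      · simp
      · intro j hj
        have : j ≠ i := Finset.ne_of_mem_erase hj
        simp [hf, this, lintegral_indicator_one hTm.compl, hq]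
  have hpt : ∀ ω, ∑ i, ∏ j, f i j (ω j) ≤ F ω := by
    intro ω
    by_cases hex : ∃ i, ∏ j, f i j (ω j) ≠ 0
    · obtain ⟨i, hi⟩ := hex
      have hi' : ∀ j, f i j (ω j) ≠ 0 := fun j => by
        rw [Finset.prod_ne_zero_iff] at hi; exact hi j (Finset.mem_univ j)
      have hiT : ω i ∈ T := by
        have := hi' i
        simp only [hf, if_true, hG] at this
        exact Set.mem_of_indicator_ne_zero this
      rw [Finset.sum_eq_single i]
      · calc ∏ j, f i j (ω j) ≤ ∏ j, (if j = i then G (ω i) else 1) := by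
              apply Finset.prod_le_prod'
              intro j _
              by_cases hji : j = i
              · subst hji; simp [hf]
              · simp only [hf, hji, if_false]
                exact Set.indicator_le_self' (fun _ _ => zero_le) _
          _ = G (ω i) := by simp
          _ ≤ F ω := by
              simp only [hG, Set.indicator_of_mem hiT, hF]
              apply ENNReal.ofReal_le_ofReal
              apply Real.exp_le_exp.mpr
              rw [abs_of_nonneg (hM0 ω)]
              gcongr
              exact hle ω i
      · intro k _ hk
        apply Finset.prod_eq_zero (Finset.mem_univ i)
        simp [hf, hk.symm, hiT]
      · simp
    · push Not at hex
      simp [hex]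
  have hsum : (n : ENNReal) * ((∫⁻ z, G z ∂P) * q ^ (n - 1)) ≤ 2 := by
    calc (n : ENNReal) * ((∫⁻ z, G z ∂P) * q ^ (n - 1))
        = ∑ i, ∫⁻ ω, ∏ j, f i j (ω j) ∂μ := by simp [hprod]
      _ = ∫⁻ ω, ∑ i, ∏ j, f i j (ω j) ∂μ := by
          rw [lintegral_finsetSum]
          intro i _
          exact Finset.measurable_prod _ fun j _ => (hfm i j).comp (measurable_pi_apply j)
      _ ≤ ∫⁻ ω, F ω ∂μ := lintegral_mono hpt
      _ ≤ 2 := hc2'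
  have h3 : (n : ENNReal) * (∫⁻ z, G z ∂P) * (1 / 2) ≤ 2 := by
    refine le_trans ?_ hsum
    rw [← mul_assoc]
    gcongr
  calc (n : ENNReal) * (∫⁻ z, G z ∂P) = ((n : ENNReal) * (∫⁻ z, G z ∂P) * (1 / 2)) * 2 := by
        rw [mul_assoc _ (1 / 2), one_div, ENNReal.inv_mul_cancel] <;> simp
    _ ≤ 2 * 2 := by gcongr
    _ = 4 := by norm_num

lemma aux_exp (y : ℝ) : Real.exp y ≤ 1 + y + y ^ 2 * Real.exp |y| := by
  have h := Complex.norm_exp_sub_sum_le_norm_mul_exp (y : ℂ) 2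
  simp only [Finset.sum_range_succ, Finset.sum_range_zero, Complex.norm_real] at h
  have h2 : Complex.exp y - (0 + (y : ℂ) ^ 0 / (Nat.factorial 0 : ℕ) + (y : ℂ) ^ 1 / (Nat.factorial 1 : ℕ))
      = ((Real.exp y - (1 + y) : ℝ) : ℂ) := by
    push_cast; simp
  rw [h2, Complex.norm_real, Real.norm_eq_abs, Real.norm_eq_abs, sq_abs] at h
  linarith [le_abs_self (Real.exp y - (1 + y))]

lemma aux_pt (c l v : ℝ) (hc : 0 < c) (hl : 0 ≤ l) (hl2 : l * (2 * c) ≤ 1) :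
    Real.exp (l * v) ≤ 1 + l * v + l ^ 2 * (2 * v ^ 2 + 8 * c ^ 2 *
      (if c * Real.log 4 < |v| then Real.exp (|v| / c) else 0)) := by
  refine (aux_exp (l * v)).trans ?_
  have habs : |l * v| = l * |v| := by rw [abs_mul, abs_of_nonneg hl]
  have hv := abs_nonneg v
  have hlc : l ≤ 1 / (2 * c) := by rw [le_div_iff₀ (by positivity)]; exact hl2
  have hle : l * |v| ≤ |v| / c / 2 := by
    calc l * |v| ≤ 1 / (2 * c) * |v| := by gcongr
      _ = |v| / c / 2 := by field_simp
  have key : v ^ 2 * Real.exp (|l * v|) ≤ 2 * v ^ 2 + 8 * c ^ 2 *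
      (if c * Real.log 4 < |v| then Real.exp (|v| / c) else 0) := by
    rw [habs]
    split_ifs with h
    · set y := |v| / c with hy
      have hy0 : 0 ≤ y := by positivity
      have hvy : v ^ 2 = c ^ 2 * y ^ 2 := by rw [hy, div_pow, sq_abs]; field_simp
      have h1 := Real.quadratic_le_exp_of_nonneg (x := y / 2) (by positivity)
      have h2 : y ^ 2 ≤ 8 * Real.exp (y / 2) := by nlinarith
      have h3 : Real.exp (l * |v|) ≤ Real.exp (y / 2) := Real.exp_le_exp.mpr hle
      have h4 : Real.exp y = Real.exp (y / 2) * Real.exp (y / 2) := by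
        rw [← Real.exp_add]; congr 1; ring
      have h5 : v ^ 2 * Real.exp (l * |v|) ≤ 8 * c ^ 2 * Real.exp y := by
        rw [hvy, h4]
        calc c ^ 2 * y ^ 2 * Real.exp (l * |v|)
            ≤ c ^ 2 * (8 * Real.exp (y / 2)) * Real.exp (y / 2) := by gcongr
          _ = _ := by ring
      nlinarith [sq_nonneg v]
    · push Not at h
      have h1 : Real.exp (l * |v|) ≤ 2 := by
        have : l * |v| ≤ Real.log 2 := by
          refine hle.trans ?_
          have h4 : Real.log 4 = 2 * Real.log 2 := by
            rw [show (4 : ℝ) = 2 ^ 2 by norm_num, Real.log_pow]; norm_num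
          have : |v| / c ≤ Real.log 4 := by rw [div_le_iff₀ hc]; linarith
          linarith
        calc Real.exp (l * |v|) ≤ Real.exp (Real.log 2) := Real.exp_le_exp.mpr this
          _ = 2 := Real.exp_log (by norm_num)
      nlinarith [sq_nonneg v]
  nlinarith [sq_nonneg l, mul_le_mul_of_nonneg_left key (sq_nonneg l)]

lemma aux_mgf {𝒵 : Type} [MeasurableSpace 𝒵] (P : Measure 𝒵)
    [IsProbabilityMeasure P] {n : ℕ} (hn : 0 < n) (g : 𝒵 → ℝ) (hg : Measurable g)
    (hi : Integrable g P) (hi2 : Integrable (fun z => (g z) ^ 2) P) (c : ℝ)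
    (hc : c ∈ psi1Set (Measure.pi fun _ : Fin n => P) (fun ω => ⨆ k : Fin n, |g (ω k)|))
    (l : ℝ) (hl : 0 ≤ l) (hl2 : l * (2 * c) ≤ 1) :
    ∫⁻ z, ENNReal.ofReal (Real.exp (l * g z)) ∂P ≤
      ENNReal.ofReal (Real.exp (l * ∫ z, g z ∂P + 2 * l ^ 2 * ∫ z, (g z) ^ 2 ∂P
        + 32 * l ^ 2 * c ^ 2 / n)) := by
  have htail := aux_tail P hn g hg c hc
  have hc0 : 0 < c := hc.1
  have hn0 : (0 : ℝ) < n := by exact_mod_cast hn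
  set T : Set 𝒵 := {z | c * Real.log 4 < |g z|} with hT
  have hTm : MeasurableSet T := measurableSet_lt measurable_const (by fun_prop)
  set H : 𝒵 → ℝ := T.indicator (fun z => Real.exp (|g z| / c)) with hH
  have hHm : Measurable H := by
    apply Measurable.indicator _ hTm
    fun_prop
  have hH0 : ∀ z, 0 ≤ H z := fun z => Set.indicator_nonneg (fun _ _ => (Real.exp_pos _).le) z
  have hGH : ∀ z, T.indicator (fun z => ENNReal.ofReal (Real.exp (|g z| / c))) z
      = ENNReal.ofReal (H z) := by
    intro z
    by_cases hz : z ∈ T <;> simp [hH, hz]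
  simp_rw [hGH] at htail
  have hfin : ∫⁻ z, ENNReal.ofReal (H z) ∂P ≠ ⊤ := by
    intro h
    rw [h, ENNReal.mul_top (by exact_mod_cast hn.ne')] at htail
    simp at htail
  have hHi : Integrable H P := by
    refine ⟨hHm.aestronglyMeasurable, ?_⟩
    rw [hasFiniteIntegral_iff_ofReal (Filter.Eventually.of_forall hH0)]
    exact hfin.lt_top
  have hHint : ∫ z, H z ∂P ≤ 4 / n := by
    rw [integral_eq_lintegral_of_nonneg_ae (Filter.Eventually.of_forall hH0)
      hHm.aestronglyMeasurable, le_div_iff₀ hn0]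
    have := ENNReal.toReal_mono (by norm_num) htail
    rw [ENNReal.toReal_mul] at this
    simp at this
    linarith
  set R : 𝒵 → ℝ := fun z => 1 + l * g z + l ^ 2 * (2 * (g z) ^ 2 + 8 * c ^ 2 * H z) with hR
  have hpt : ∀ z, Real.exp (l * g z) ≤ R z := by
    intro z
    refine (aux_pt c l (g z) hc0 hl hl2).trans (le_of_eq ?_)
    simp only [hR, hH, Set.indicator, hT, Set.mem_setOf_eq]
  have hi1 : Integrable (fun z => 1 + l * g z) P := (integrable_const _).add (hi.const_mul l)
  have hi3 : Integrable (fun z => 2 * (g z) ^ 2 + 8 * c ^ 2 * H z) P :=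
    (hi2.const_mul 2).add (hHi.const_mul _)
  have hRi : Integrable R P := hi1.add (hi3.const_mul _)
  have hRint : ∫ z, R z ∂P = 1 + l * ∫ z, g z ∂P + l ^ 2 * (2 * ∫ z, (g z) ^ 2 ∂P
      + 8 * c ^ 2 * ∫ z, H z ∂P) := by
    simp only [hR]
    rw [integral_add hi1 (hi3.const_mul _), integral_add (integrable_const _) (hi.const_mul l),
      integral_const_mul, integral_const_mul, integral_add (hi2.const_mul 2) (hHi.const_mul _),
      integral_const_mul, integral_const_mul]
    simp
  calc ∫⁻ z, ENNReal.ofReal (Real.exp (l * g z)) ∂P ≤ ∫⁻ z, ENNReal.ofReal (R z) ∂P :=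
        lintegral_mono fun z => ENNReal.ofReal_le_ofReal (hpt z)
    _ = ENNReal.ofReal (∫ z, R z ∂P) := by
        rw [ofReal_integral_eq_lintegral_ofReal hRi]
        exact Filter.Eventually.of_forall fun z => (Real.exp_pos _).le.trans (hpt z)
    _ ≤ _ := by
        apply ENNReal.ofReal_le_ofReal
        rw [hRint]
        refine le_trans ?_ (Real.add_one_le_exp _)
        have h := mul_le_mul_of_nonneg_left hHint (show 0 ≤ l ^ 2 * (8 * c ^ 2) by positivity)
        have h2 : l ^ 2 * (8 * c ^ 2) * (4 / n) = 32 * l ^ 2 * c ^ 2 / n := by ring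
        nlinarith

lemma aux_chernoff {𝒵 : Type} [MeasurableSpace 𝒵] (P : Measure 𝒵)
    [IsProbabilityMeasure P] {n : ℕ} (hn : 0 < n) (g : 𝒵 → ℝ) (hg : Measurable g)
    (l A x U : ℝ) (hl : 0 < l)
    (hA : ∫⁻ z, ENNReal.ofReal (Real.exp (l * g z)) ∂P ≤ ENNReal.ofReal (Real.exp A))
    (hU : n * A + x ≤ l * (n * U)) :
    ENNReal.ofReal (1 - 4 * Real.exp (-x)) ≤
      (Measure.pi fun _ : Fin n => P) {ω | empMean n g ω ≤ U} := by
  have hn0 : (0 : ℝ) < n := by exact_mod_cast hn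
  set μ := Measure.pi fun _ : Fin n => P with hμ
  have hem : Measurable (empMean n g) := by
    unfold empMean
    apply Measurable.div_const
    exact Finset.measurable_sum _ fun i _ => hg.comp (measurable_pi_apply i)
  have hS : MeasurableSet {ω | empMean n g ω ≤ U} := measurableSet_le hem measurable_const
  set F : (Fin n → 𝒵) → ENNReal := fun ω => ∏ i, ENNReal.ofReal (Real.exp (l * g (ω i))) with hF
  have hFm : Measurable F :=
    Finset.measurable_prod _ fun i _ => by
      have := hg.comp (measurable_pi_apply (X := fun _ : Fin n => 𝒵) i)
      exact ((this.const_mul l).exp).ennreal_ofReal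
  have hFi : ∫⁻ ω, F ω ∂μ ≤ ENNReal.ofReal (Real.exp (n * A)) := by
    have h := aux_lintegral_pi_prod P (n := n)
      (fun _ z => ENNReal.ofReal (Real.exp (l * g z))) (fun _ => by fun_prop)
    simp only [hF, hμ]
    rw [h]
    simp only [Finset.prod_const, Finset.card_univ, Fintype.card_fin]
    rw [Real.exp_nat_mul, ENNReal.ofReal_pow (Real.exp_pos _).le]
    gcongr
  have hmark : ENNReal.ofReal (Real.exp (n * A + x)) * μ {ω | empMean n g ω ≤ U}ᶜ
      ≤ ENNReal.ofReal (Real.exp (n * A)) := by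
    refine le_trans ?_ ((mul_meas_ge_le_lintegral hFm
      (ENNReal.ofReal (Real.exp (n * A + x)))).trans hFi)
    gcongr
    intro ω hω
    have hω' : U < empMean n g ω := by simpa using hω
    show _ ≤ F ω
    simp only [hF]
    rw [← ENNReal.ofReal_prod_of_nonneg (fun _ _ => (Real.exp_pos _).le), ← Real.exp_sum,
      ← Finset.mul_sum]
    apply ENNReal.ofReal_le_ofReal
    apply Real.exp_le_exp.mpr
    refine hU.trans ?_
    unfold empMean at hω'
    rw [lt_div_iff₀ hn0] at hω'
    gcongr
    linarith
  have hbad : μ {ω | empMean n g ω ≤ U}ᶜ ≤ ENNReal.ofReal (Real.exp (-x)) := by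
    rw [Real.exp_add, ENNReal.ofReal_mul (Real.exp_pos _).le, mul_assoc] at hmark
    have h1 : ENNReal.ofReal (Real.exp x) * μ {ω | empMean n g ω ≤ U}ᶜ ≤ 1 := by
      have h0 : ENNReal.ofReal (Real.exp (n * A)) ≠ 0 := by simp [Real.exp_pos]
      rw [← ENNReal.mul_le_mul_iff_right h0 ENNReal.ofReal_ne_top, mul_one]
      exact hmark
    calc μ {ω | empMean n g ω ≤ U}ᶜ
        = ENNReal.ofReal (Real.exp (-x)) *
          (ENNReal.ofReal (Real.exp x) * μ {ω | empMean n g ω ≤ U}ᶜ) := by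
          rw [← mul_assoc, ← ENNReal.ofReal_mul (Real.exp_pos _).le, ← Real.exp_add]
          simp
      _ ≤ ENNReal.ofReal (Real.exp (-x)) * 1 := by gcongr
      _ = _ := mul_one _
  have hcompl : μ {ω | empMean n g ω ≤ U} = 1 - μ {ω | empMean n g ω ≤ U}ᶜ := by
    rw [← prob_compl_eq_one_sub hS.compl, compl_compl]
  rw [hcompl]
  calc ENNReal.ofReal (1 - 4 * Real.exp (-x)) ≤ ENNReal.ofReal (1 - Real.exp (-x)) := by
        apply ENNReal.ofReal_le_ofReal
        linarith [Real.exp_pos (-x)]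
    _ = 1 - ENNReal.ofReal (Real.exp (-x)) := by
        rw [ENNReal.ofReal_sub _ (Real.exp_pos _).le, ENNReal.ofReal_one]
    _ ≤ _ := tsub_le_tsub_left hbad _

/-- Final real-number bookkeeping. -/
lemma aux_final (n s v B c b α x : ℝ) (hn : 0 < n) (hB : 0 ≤ B) (hc : 0 < c)
    (hb : 0 ≤ b) (hcb : c ≤ 2 * (b + B)) (hα : 0 < α) (hα1 : α < 1) (hx : 0 < x)
    (hs : 0 ≤ s + B / n) (hv : v ≤ B * s + B ^ 2 / n) :
    n * (α / (2 * (c + B)) * s + 2 * (α / (2 * (c + B))) ^ 2 * v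
        + 32 * (α / (2 * (c + B))) ^ 2 * c ^ 2 / n) + x ≤
      α / (2 * (c + B)) * (n * ((1 + 2 * α) * s + 60 * (1 + α⁻¹) * (b + B) * (x + 1) / n)) := by
  have hD : 0 < c + B := by linarith
  set D := c + B with hDdef
  set l := α / (2 * D) with hl
  have hl0 : 0 < l := by positivity
  have hlD : 2 * l * D = α := by rw [hl]; field_simp
  have hxl : x = l * (2 * D * α⁻¹ * x) := by
    rw [show l * (2 * D * α⁻¹ * x) = (2 * l * D) * α⁻¹ * x by ring, hlD]; field_simp
  have h1 : n * (l * s + 2 * l ^ 2 * v + 32 * l ^ 2 * c ^ 2 / n) + x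
      = l * (n * s + n * (2 * l * v) + 32 * l * c ^ 2 + 2 * D * α⁻¹ * x) := by
    have e : n * (32 * l ^ 2 * c ^ 2 / n) = 32 * l ^ 2 * c ^ 2 := by field_simp
    calc n * (l * s + 2 * l ^ 2 * v + 32 * l ^ 2 * c ^ 2 / n) + x
        = n * (l * s + 2 * l ^ 2 * v) + n * (32 * l ^ 2 * c ^ 2 / n) + x := by ring
      _ = n * (l * s + 2 * l ^ 2 * v) + 32 * l ^ 2 * c ^ 2 + l * (2 * D * α⁻¹ * x) := by
          rw [e, ← hxl]
      _ = _ := by ring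
  rw [h1]
  apply mul_le_mul_of_nonneg_left _ hl0.le
  have h2 : n * ((1 + 2 * α) * s + 60 * (1 + α⁻¹) * (b + B) * (x + 1) / n)
      = (1 + 2 * α) * (n * s) + 60 * (1 + α⁻¹) * (b + B) * (x + 1) := by
    field_simp
  rw [h2]
  have hs' : 0 ≤ n * s + B := by
    have := mul_nonneg hn.le hs
    rwa [mul_add, mul_div_cancel₀ _ hn.ne'] at this
  have hv' : n * v ≤ B * (n * s) + B ^ 2 := by
    have := mul_le_mul_of_nonneg_left hv hn.le
    have h : n * (B * s + B ^ 2 / n) = B * (n * s) + B ^ 2 := by field_simp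
    linarith
  have hlB : 2 * l * B ≤ α := by rw [← hlD]; gcongr; linarith
  have hlc : 2 * l * c ≤ α := by rw [← hlD]; gcongr; linarith
  have hlB0 : 0 ≤ 2 * l * B := by positivity
  -- n * (2 l v) ≤ 2 l B (n s + B) ≤ α (n s + B)
  have h3 : n * (2 * l * v) ≤ α * (n * s + B) := by
    have := mul_le_mul_of_nonneg_left hv' (show 0 ≤ 2 * l by positivity)
    have h := mul_le_mul_of_nonneg_right hlB hs'
    nlinarith
  have h3' : α * (n * s + B) ≤ 2 * α * (n * s) + 2 * B := by nlinarith
  have h4 : 32 * l * c ^ 2 ≤ 16 * c := by nlinarith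
  have hbB : 0 < b + B := by linarith
  have hα' : 0 < α⁻¹ := by positivity
  set E := b + B with hE
  have hD3 : D ≤ 3 * E := by linarith
  have h5 : 2 * D * α⁻¹ * x ≤ 2 * (3 * E) * α⁻¹ * x := by gcongr
  have h6 : 0 ≤ E * α⁻¹ * x := by positivity
  have h7 : 0 ≤ E * x := by positivity
  have h8 : 0 ≤ E * α⁻¹ := by positivity
  have h9 : 60 * (1 + α⁻¹) * E * (x + 1)
      = 60 * E + 60 * (E * x) + 60 * (E * α⁻¹) + 60 * (E * α⁻¹ * x) := by ring
  rw [h9]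
  linarith

/-- **Deviation inequality for a single function under a Bernstein-type condition.**
With probability at least `1 − 4e^{−x}`,
`P_n g ≤ (1 + 2α) P g + K′ (1 + α⁻¹) (b_n(g) + B_n)(x + 1)/n`. -/
theorem single_function_deviation_bernstein :
    ∃ K' : ℝ, 0 < K' ∧
      ∀ (𝒵 : Type) (_ : MeasurableSpace 𝒵) (P : Measure 𝒵), IsProbabilityMeasure P →
      ∀ (n : ℕ), 0 < n →
      ∀ (g : 𝒵 → ℝ), Measurable g →
        Integrable g P → Integrable (fun z => (g z) ^ 2) P →
        -- `b_n(g) < ∞`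
        (psi1Set (Measure.pi fun _ : Fin n => P)
          (fun ω => ⨆ k : Fin n, |g (ω k)|)).Nonempty →
      ∀ (Bn : ℝ), 0 ≤ Bn →
        -- Bernstein-type condition: `P g² ≤ B_n P g + B_n²/n`
        (∫ z, (g z) ^ 2 ∂P ≤ Bn * ∫ z, g z ∂P + Bn ^ 2 / n) →
      ∀ (α : ℝ), 0 < α → α < 1 → ∀ (x : ℝ), 0 < x →
        ENNReal.ofReal (1 - 4 * Real.exp (-x)) ≤
          (Measure.pi fun _ : Fin n => P)
            {ω | empMean n g ω ≤
              (1 + 2 * α) * ∫ z, g z ∂P +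
                K' * (1 + α⁻¹) * (bnFun P n g + Bn) * (x + 1) / n} := by
  refine ⟨60, by norm_num, ?_⟩
  intro 𝒵 _ P hP n hn g hg hi hi2 hne Bn hBn hbern α hα hα1 x hx
  have hn0 : (0 : ℝ) < n := by exact_mod_cast hn
  have hbdd : BddBelow (psi1Set (Measure.pi fun _ : Fin n => P)
      (fun ω => ⨆ k : Fin n, |g (ω k)|)) := ⟨0, fun c hc => hc.1.le⟩
  have hb : 0 ≤ bnFun P n g := Real.sInf_nonneg fun c hc => hc.1.le
  have hvar : (∫ z, g z ∂P) ^ 2 ≤ ∫ z, (g z) ^ 2 ∂P := by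
    have h := ProbabilityTheory.variance_nonneg g P
    rw [ProbabilityTheory.variance_eq_sub ((memLp_two_iff_integrable_sq hi.1).2 hi2)] at h
    simp only [Pi.pow_apply] at h
    linarith
  by_cases hpos : 0 < bnFun P n g + Bn
  · obtain ⟨c, hc, hcb⟩ := exists_lt_of_csInf_lt hne
      (show sInf _ < bnFun P n g + (bnFun P n g + Bn) from lt_add_of_pos_right _ hpos)
    have hc0 : 0 < c := hc.1
    have hs : 0 ≤ (∫ z, g z ∂P) + Bn / n := by
      rcases hBn.eq_or_lt with h0 | h0
      · subst h0
        have : (∫ z, g z ∂P) ^ 2 ≤ 0 := by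
          refine hvar.trans (hbern.trans (le_of_eq ?_)); simp
        have : (∫ z, g z ∂P) = 0 := by nlinarith
        simp [this]
      · have h1 : 0 ≤ Bn * ((∫ z, g z ∂P) + Bn / n) := by
          have : 0 ≤ Bn * (∫ z, g z ∂P) + Bn ^ 2 / n :=
            (integral_nonneg fun z => sq_nonneg (g z)).trans hbern
          calc 0 ≤ _ := this
            _ = _ := by ring
        exact nonneg_of_mul_nonneg_right h1 h0
    have hl0 : 0 < α / (2 * (c + Bn)) := by positivity
    refine aux_chernoff P hn g hg (α / (2 * (c + Bn))) _ x _ hl0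
      (aux_mgf P hn g hg hi hi2 c hc _ hl0.le ?_)
      (aux_final n _ _ Bn c (bnFun P n g) α x hn0 hBn hc0 hb (by linarith) hα hα1 hx hs hbern)
    rw [div_mul_eq_mul_div, div_le_one (by positivity)]
    nlinarith
  · have hB0 : Bn = 0 := by linarith
    have hb0 : bnFun P n g = 0 := by linarith
    subst hB0
    have hz : ∫ z, (g z) ^ 2 ∂P = 0 := by
      refine le_antisymm (hbern.trans (le_of_eq (by simp)))
        (integral_nonneg fun z => sq_nonneg (g z))
    have hs : ∫ z, g z ∂P = 0 := by rw [hz] at hvar; nlinarith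
    have hae : ∀ᵐ z ∂P, g z = 0 := by
      have := (integral_eq_zero_iff_of_nonneg (fun z => sq_nonneg (g z)) hi2).1 hz
      filter_upwards [this] with z hz
      simpa using hz
    have hall : ∀ᵐ ω ∂(Measure.pi fun _ : Fin n => P), ∀ i, g (ω i) = 0 :=
      ae_all_iff.2 fun i =>
        (Measure.quasiMeasurePreserving_eval (fun _ : Fin n => P) i).ae hae
    have hone : (Measure.pi fun _ : Fin n => P) {ω | empMean n g ω ≤
        (1 + 2 * α) * ∫ z, g z ∂P +
          60 * (1 + α⁻¹) * (bnFun P n g + 0) * (x + 1) / n} = 1 := by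
      rw [← measure_univ (μ := Measure.pi fun _ : Fin n => P)]
      apply measure_congr
      rw [Filter.eventuallyEq_univ]
      filter_upwards [hall] with ω hω
      simp [empMean, hω, hs, hb0]
    rw [hone]
    refine (ENNReal.ofReal_le_ofReal (q := 1) ?_).trans (by simp)
    linarith [Real.exp_pos (-x)]
end
end

section
/- Let q ≥ 2, let H be a countable class of real-valued measurable functions of a random variable W, and suppose M = ‖ sup_{h ∈ H} |h(W)|^q ‖_{ψ_1} < ∞. Then for every θ > 0, E[ sup_{h ∈ H} |h(W)|^q · 1_{|h(W)| ≥ θ} ] ≤ 2 ( θ^q + M ) · exp( −θ^q / M ). -/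
open MeasureTheory Real

noncomputable section

/-- **Tail bound for the envelope of a class with sub-exponential `q`-th powers.**
For every `θ > 0`,
`E[sup_{h ∈ H} |h(W)|^q 1_{|h(W)| ≥ θ}] ≤ 2(θ^q + M) exp(−θ^q/M)`. -/
theorem envelope_tail_bound {Ω α : Type*} [MeasurableSpace Ω] (μ : Measure Ω)
    [IsProbabilityMeasure μ] (W : Ω → α) {ι : Type*} [Countable ι]
    (h : ι → α → ℝ) (q : ℝ) (hq : 2 ≤ q) (M : ℝ)
    (hM : M = psi1 μ (fun ω => ⨆ i : ι, |h i (W ω)| ^ q))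
    (hfin : (psi1Set μ (fun ω => ⨆ i : ι, |h i (W ω)| ^ q)).Nonempty) :
    ∀ θ : ℝ, 0 < θ →
      ∫ ω, (⨆ i : ι, if θ ≤ |h i (W ω)| then |h i (W ω)| ^ q else 0) ∂μ ≤
        2 * (θ ^ q + M) * Real.exp (-(θ ^ q) / M) := by
  intro θ hθ
  set S : Ω → ℝ := fun ω => ⨆ i : ι, |h i (W ω)| ^ q with hS
  set T : Ω → ℝ := fun ω => ⨆ i : ι, if θ ≤ |h i (W ω)| then |h i (W ω)| ^ q else 0 with hT
  have hq0 : 0 < q := by linarith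
  have ha : 0 < θ ^ q := Real.rpow_pos_of_pos hθ q
  set a := θ ^ q with ha'
  have hM0 : 0 ≤ M := by
    rw [hM]
    exact Real.sInf_nonneg (fun c hc => hc.1.le)
  have hT0 : ∀ ω, 0 ≤ T ω := fun ω => Real.iSup_nonneg (fun i => by
    split_ifs <;> positivity)
  have hS0 : ∀ ω, 0 ≤ S ω := fun ω => Real.iSup_nonneg (fun i => by positivity)
  -- the truncated supremum vanishes, or is at least `a` and at most `S`
  have key : ∀ ω, T ω = 0 ∨ (a ≤ S ω ∧ T ω ≤ S ω) := by
    intro ω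
    by_cases hb : BddAbove (Set.range fun i => |h i (W ω)| ^ q)
    · by_cases he : ∃ i, θ ≤ |h i (W ω)|
      · right
        obtain ⟨i, hi⟩ := he
        refine ⟨(Real.rpow_le_rpow hθ.le hi hq0.le).trans (le_ciSup hb i), ?_⟩
        haveI : Nonempty ι := ⟨i⟩
        refine ciSup_le (fun j => ?_)
        split_ifs
        · exact le_ciSup hb j
        · exact hS0 ω
      · left
        push Not at he
        have : ∀ i, (if θ ≤ |h i (W ω)| then |h i (W ω)| ^ q else 0) = 0 :=
          fun i => if_neg (not_le.mpr (he i))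
        simp only [hT, this, Real.iSup_const_zero]
    · left
      apply Real.iSup_of_not_bddAbove
      rintro ⟨B, hB⟩
      apply hb
      refine ⟨max B a, ?_⟩
      rintro _ ⟨i, rfl⟩
      by_cases hi : θ ≤ |h i (W ω)|
      · have := hB ⟨i, rfl⟩
        simp only [if_pos hi] at this
        exact le_max_of_le_left this
      · exact le_max_of_le_right
          (Real.rpow_le_rpow (abs_nonneg _) (not_le.mp hi).le hq0.le)
  by_cases hint : Integrable T μ
  swap
  · rw [integral_undef hint]
    positivity
  have bound : ∀ c ∈ psi1Set μ S, ∫ ω, T ω ∂μ ≤ 2 * (a + c) * Real.exp (-a / c) := by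
    rintro c ⟨hc, hc2⟩
    have hK : 0 ≤ (a + c) * Real.exp (-a / c) := by positivity
    have pt : ∀ ω, T ω ≤ (a + c) * Real.exp (-a / c) * Real.exp (|S ω| / c) := by
      intro ω
      rcases key ω with h0 | ⟨h1, h2⟩
      · rw [h0]; positivity
      · refine h2.trans ?_
        rw [abs_of_nonneg (hS0 ω), mul_assoc, ← Real.exp_add]
        have e : -a / c + S ω / c = (S ω - a) / c := by ring
        rw [e]
        have h3 := Real.add_one_le_exp ((S ω - a) / c)
        have h4 : 0 ≤ (S ω - a) / c := div_nonneg (by linarith) hc.le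
        have h5 : c * ((S ω - a) / c) = S ω - a := by field_simp
        nlinarith [mul_le_mul_of_nonneg_left h3 (by positivity : 0 ≤ a + c), mul_nonneg ha.le h4]
    have : ENNReal.ofReal (∫ ω, T ω ∂μ) ≤ ENNReal.ofReal (2 * (a + c) * Real.exp (-a / c)) := by
      rw [ofReal_integral_eq_lintegral_ofReal hint (Filter.Eventually.of_forall hT0)]
      calc ∫⁻ ω, ENNReal.ofReal (T ω) ∂μ
          ≤ ∫⁻ ω, ENNReal.ofReal ((a + c) * Real.exp (-a / c)) *
              ENNReal.ofReal (Real.exp (|S ω| / c)) ∂μ := by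
            refine lintegral_mono (fun ω => ?_)
            rw [← ENNReal.ofReal_mul hK]
            exact ENNReal.ofReal_le_ofReal (pt ω)
        _ = ENNReal.ofReal ((a + c) * Real.exp (-a / c)) *
              ∫⁻ ω, ENNReal.ofReal (Real.exp (|S ω| / c)) ∂μ :=
            lintegral_const_mul' _ _ ENNReal.ofReal_ne_top
        _ ≤ ENNReal.ofReal ((a + c) * Real.exp (-a / c)) * 2 := by gcongr
        _ = ENNReal.ofReal (2 * (a + c) * Real.exp (-a / c)) := by
            rw [← ENNReal.ofReal_ofNat 2, ← ENNReal.ofReal_mul hK]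
            congr 1; ring
    exact (ENNReal.ofReal_le_ofReal_iff (by positivity)).mp this
  have bound2 : ∀ c, M < c → ∫ ω, T ω ∂μ ≤ 2 * (a + c) * Real.exp (-a / c) := by
    intro c hc
    rw [hM] at hc
    obtain ⟨d, hd, hdc⟩ := exists_lt_of_csInf_lt hfin hc
    have hd0 : 0 < d := hd.1
    refine (bound d hd).trans ?_
    have : -a / d ≤ -a / c := by
      rw [neg_div, neg_div, neg_le_neg_iff]
      exact div_le_div_of_nonneg_left ha.le hd0 hdc.le
    have := Real.exp_le_exp.mpr this
    have hc0 : 0 < c := hd0.trans hdc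
    gcongr
  rcases hM0.eq_or_lt with h0 | hpos
  · rw [← h0]
    simp only [add_zero, div_zero, Real.exp_zero, mul_one]
    refine le_of_forall_pos_le_add (fun ε hε => ?_)
    have := bound2 (ε / 2) (by linarith)
    have h1 : Real.exp (-a / (ε / 2)) ≤ 1 :=
      Real.exp_le_one_iff.mpr (div_nonpos_of_nonpos_of_nonneg (by linarith) (by linarith))
    nlinarith
  · have hc : ContinuousAt (fun c : ℝ => 2 * (a + c) * Real.exp (-a / c)) M := by
      have : M ≠ 0 := hpos.ne'
      fun_prop (disch := assumption)
    refine ge_of_tendsto (hc.tendsto.mono_left (nhdsWithin_le_nhds (s := Set.Ioi M))) ?_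
    filter_upwards [self_mem_nhdsWithin] with c hc using bound2 c hc
end
end
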